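/- Let X be a real vector space and suppose that for each n ∈ ℕ and each x = (x₁, …, xₙ) ∈ Xⁿ there is a linear map Ψ_x : PG_n^h → X such that: (a) Ψ_x(πᵢ) = xᵢ for i = 1, …, n; and (b) Ψ_{(Ψ_x(f₁), …, Ψ_x(f_m))}(g) = Ψ_x(g ∘ (f₁ × ⋯ × f_m)) whenever f₁, …, f_m ∈ PG_n^h and g ∈ PG_m^h are such that g ∘ (f₁ × ⋯ × f_m) ∈ PG_n^h, where (f₁ × ⋯ × f_m)(t) = (f₁(t), …, f_m(t)). Define a relation on X by x ≤ y iff Ψ_{(x,y)}(π₁ ∨ π₂) = y, and a product by x·y := Ψ_{(x,y)}(π₁·π₂). Then ≤ is a lattice order making X a vector lattice with x ∨ y = Ψ_{(x,y)}(π₁ ∨ π₂), the product makes X a commutative associative real algebra, and X with these structures is a commutative f-algebra; moreover each Ψ_x : PG_n^h → X is then a lattice-algebra homomorphism, so X admits a polynomial growth continuous function calculus without constants. -/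

import Mathlib

open scoped BigOperators

/-- A continuous function `ℝⁿ → ℝ` of polynomial growth (an element of `PG_n`). -/
def PolyGrowth (n : ℕ) (f : (Fin n → ℝ) → ℝ) : Prop :=
  Continuous f ∧ ∃ (M : ℝ) (N : ℕ), 0 ≤ M ∧
    ∀ t : Fin n → ℝ, |f t| ≤ M * (1 + ∑ i : Fin n, |t i|) ^ N

/-- An element of `PG_n^h`: a polynomial growth continuous function `f` such that
`f (t • x) / t` converges as `t → 0⁺`, uniformly in `x` on every bounded set. -/
def PolyGrowthH (n : ℕ) (f : (Fin n → ℝ) → ℝ) : Prop :=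
  PolyGrowth n f ∧ ∃ fh : (Fin n → ℝ) → ℝ,
    ∀ B : Set (Fin n → ℝ), Bornology.IsBounded B →
      ∀ ε : ℝ, 0 < ε → ∃ δ : ℝ, 0 < δ ∧
        ∀ t : ℝ, 0 < t → t < δ → ∀ y ∈ B, |f (t • y) / t - fh y| < ε

/-- An element of `H_n`: a continuous positively homogeneous function `ℝⁿ → ℝ`. -/
def PosHomog (n : ℕ) (f : (Fin n → ℝ) → ℝ) : Prop :=
  Continuous f ∧ ∀ (c : ℝ), 0 ≤ c → ∀ t : Fin n → ℝ, f (c • t) = c * f t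

section Defs

variable {X : Type*} [Lattice X] [AddCommGroup X] [Module ℝ X]

/-- The order ideal `I_e` generated by `e`. -/
def idealSet (e : X) : Set X := {x : X | ∃ c : ℝ, 0 ≤ c ∧ |x| ≤ c • e}

/-- The norm `‖x‖_e = inf {c ≥ 0 : |x| ≤ c • e}`. -/
noncomputable def regNorm (e x : X) : ℝ := sInf {c : ℝ | 0 ≤ c ∧ |x| ≤ c • e}

/-- The norm `‖·‖_e` is complete on the set `S`: every `‖·‖_e`-Cauchy sequence in `S`
converges, in `‖·‖_e`, to an element of `S`. -/
def NormComplete (e : X) (S : Set X) : Prop :=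
  ∀ u : ℕ → X, (∀ k, u k ∈ S) →
    (∀ ε : ℝ, 0 < ε → ∃ N : ℕ, ∀ p q : ℕ, N ≤ p → N ≤ q → regNorm e (u p - u q) < ε) →
    ∃ x ∈ S, ∀ ε : ℝ, 0 < ε → ∃ N : ℕ, ∀ p : ℕ, N ≤ p → regNorm e (u p - x) < ε

/-- A uniformly complete vector lattice: `(I_e, ‖·‖_e)` is complete for every `e ≥ 0`. -/
def UniformlyComplete (X : Type*) [Lattice X] [AddCommGroup X] [Module ℝ X] : Prop :=
  ∀ e : X, 0 ≤ e → NormComplete e (idealSet e)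

/-- A subset `Z` is uniformly complete as a vector lattice in its own right. -/
def UCSet (Z : Set X) : Prop :=
  ∀ e ∈ Z, 0 ≤ e → NormComplete e (Z ∩ idealSet e)

/-- A (vector) sublattice: a linear subspace closed under binary suprema. -/
def IsSublatticeSet (Z : Set X) : Prop :=
  (0 ∈ Z) ∧ (∀ a ∈ Z, ∀ b ∈ Z, a + b ∈ Z) ∧ (∀ (c : ℝ), ∀ a ∈ Z, c • a ∈ Z) ∧
  (∀ a ∈ Z, -a ∈ Z) ∧ (∀ a ∈ Z, ∀ b ∈ Z, a ⊔ b ∈ Z) ∧ (∀ a ∈ Z, ∀ b ∈ Z, a ⊓ b ∈ Z)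

/-- An order ideal: a linear subspace that is solid. -/
def IsOrderIdealSet (I : Set X) : Prop :=
  (0 ∈ I) ∧ (∀ a ∈ I, ∀ b ∈ I, a + b ∈ I) ∧ (∀ (c : ℝ), ∀ a ∈ I, c • a ∈ I) ∧
  (∀ a ∈ I, ∀ b : X, |b| ≤ |a| → b ∈ I)

/-- A vector lattice homomorphism defined on the class of functions `ℝⁿ → ℝ`
satisfying the predicate `P` (with pointwise operations), taking values in `X`. -/
def IsLatHom {n : ℕ} (P : ((Fin n → ℝ) → ℝ) → Prop) (Φ : ∀ f, P f → X) : Prop :=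
  (∀ (f g : (Fin n → ℝ) → ℝ) (hf : P f) (hg : P g) (hfg : P (f + g)),
      Φ (f + g) hfg = Φ f hf + Φ g hg) ∧
  (∀ (c : ℝ) (f : (Fin n → ℝ) → ℝ) (hf : P f) (hcf : P (c • f)),
      Φ (c • f) hcf = c • Φ f hf) ∧
  (∀ (f g : (Fin n → ℝ) → ℝ) (hf : P f) (hg : P g) (hfg : P (f ⊔ g)),
      Φ (f ⊔ g) hfg = Φ f hf ⊔ Φ g hg)

end Defs

section MulDefs

variable {X : Type*} [Lattice X] [AddCommGroup X] [Module ℝ X] [Mul X]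

/-- A lattice-algebra homomorphism defined on the class of functions `ℝⁿ → ℝ`
satisfying the predicate `P` (with pointwise operations), taking values in `X`. -/
def IsLatAlgHom {n : ℕ} (P : ((Fin n → ℝ) → ℝ) → Prop) (Ψ : ∀ f, P f → X) : Prop :=
  IsLatHom P Ψ ∧
  (∀ (f g : (Fin n → ℝ) → ℝ) (hf : P f) (hg : P g) (hfg : P (f * g)),
      Ψ (f * g) hfg = Ψ f hf * Ψ g hg)

/-- A sublattice-algebra: a linear subspace that is both a sublattice and a subalgebra. -/
def IsSublatticeAlgebraSet (Z : Set X) : Prop :=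
  IsSublatticeSet Z ∧ ∀ a ∈ Z, ∀ b ∈ Z, a * b ∈ Z

/-- The `f`-algebra condition, relativized to a subset. -/
def IsFAlgebraSet (Z : Set X) : Prop :=
  ∀ a ∈ Z, ∀ b ∈ Z, ∀ z ∈ Z, a ⊓ b = 0 → 0 ≤ z → (z * a) ⊓ b = 0 ∧ (a * z) ⊓ b = 0

/-- An `f`-subalgebra: a sublattice-algebra which is itself an `f`-algebra. -/
def IsFSubalgebra (Z : Set X) : Prop := IsSublatticeAlgebraSet Z ∧ IsFAlgebraSet Z

/-- `powS e m = e^(m+1)`, defined without assuming an identity element. -/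
def powS (e : X) : ℕ → X
  | 0 => e
  | m + 1 => powS e m * e

end MulDefs

/-- A map `T : X → A` which is a lattice-algebra homomorphism on a subset `S` of `X`. -/
def IsLatAlgHomOn {X A : Type*} [Lattice X] [AddCommGroup X] [Module ℝ X] [Mul X]
    [Lattice A] [AddCommGroup A] [Module ℝ A] [Mul A] (S : Set X) (T : X → A) : Prop :=
  (∀ a ∈ S, ∀ b ∈ S, T (a + b) = T a + T b) ∧
  (∀ (c : ℝ), ∀ a ∈ S, T (c • a) = c • T a) ∧
  (∀ a ∈ S, ∀ b ∈ S, T (a ⊔ b) = T a ⊔ T b) ∧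
  (∀ a ∈ S, ∀ b ∈ S, T (a * b) = T a * T b)

namespace PolyGrowth

variable {n : ℕ} {f g : (Fin n → ℝ) → ℝ}

/-- If `|h|` is dominated by `|f| + |g|` and `h` is continuous, then `h` inherits polynomial
growth from `f` and `g`. -/
theorem of_abs_le_add {h : (Fin n → ℝ) → ℝ} (hf : PolyGrowth n f) (hg : PolyGrowth n g)
    (hc : Continuous h) (hle : ∀ t, |h t| ≤ |f t| + |g t|) : PolyGrowth n h := by
  obtain ⟨-, M₁, N₁, hM₁, hf⟩ := hf
  obtain ⟨-, M₂, N₂, hM₂, hg⟩ := hg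
  refine ⟨hc, M₁ + M₂, N₁ + N₂, add_nonneg hM₁ hM₂, fun t => ?_⟩
  have hA : 1 ≤ 1 + ∑ i : Fin n, |t i| :=
    le_add_of_nonneg_right (Finset.sum_nonneg fun i _ => abs_nonneg _)
  calc |h t| ≤ |f t| + |g t| := hle t
    _ ≤ M₁ * (1 + ∑ i : Fin n, |t i|) ^ N₁ + M₂ * (1 + ∑ i : Fin n, |t i|) ^ N₂ :=
      add_le_add (hf t) (hg t)
    _ ≤ M₁ * (1 + ∑ i : Fin n, |t i|) ^ (N₁ + N₂)
          + M₂ * (1 + ∑ i : Fin n, |t i|) ^ (N₁ + N₂) := by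
      gcongr <;> first | exact hA | omega
    _ = _ := by ring

theorem add (hf : PolyGrowth n f) (hg : PolyGrowth n g) : PolyGrowth n (f + g) :=
  hf.of_abs_le_add hg (hf.1.add hg.1) fun t => abs_add_le (f t) (g t)

theorem sup (hf : PolyGrowth n f) (hg : PolyGrowth n g) : PolyGrowth n (f ⊔ g) :=
  hf.of_abs_le_add hg (hf.1.sup hg.1) fun _ =>
    abs_max_le_max_abs_abs.trans (max_le_add_of_nonneg (abs_nonneg _) (abs_nonneg _))

theorem mul (hf : PolyGrowth n f) (hg : PolyGrowth n g) : PolyGrowth n (f * g) := by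
  obtain ⟨hfc, M₁, N₁, hM₁, hf⟩ := hf
  obtain ⟨hgc, M₂, N₂, hM₂, hg⟩ := hg
  refine ⟨hfc.mul hgc, M₁ * M₂, N₁ + N₂, mul_nonneg hM₁ hM₂, fun t => ?_⟩
  calc |(f * g) t| = |f t| * |g t| := abs_mul _ _
    _ ≤ (M₁ * (1 + ∑ i : Fin n, |t i|) ^ N₁) * (M₂ * (1 + ∑ i : Fin n, |t i|) ^ N₂) :=
      mul_le_mul (hf t) (hg t) (abs_nonneg _) ((abs_nonneg _).trans (hf t))
    _ = _ := by ring

theorem smul (c : ℝ) (hf : PolyGrowth n f) : PolyGrowth n (c • f) := by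
  obtain ⟨hfc, M, N, hM, hf⟩ := hf
  refine ⟨hfc.const_smul c, |c| * M, N, mul_nonneg (abs_nonneg c) hM, fun t => ?_⟩
  calc |(c • f) t| = |c| * |f t| := abs_mul _ _
    _ ≤ |c| * (M * (1 + ∑ i : Fin n, |t i|) ^ N) := by gcongr; exact hf t
    _ = _ := by ring

theorem proj (i : Fin n) : PolyGrowth n fun t => t i := by
  refine ⟨continuous_apply i, 1, 1, zero_le_one, fun t => ?_⟩
  have := Finset.single_le_sum (f := fun j => |t j|) (fun j _ => abs_nonneg _)
    (Finset.mem_univ i)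
  linarith

end PolyGrowth

namespace PolyGrowthH

variable {n : ℕ} {f g : (Fin n → ℝ) → ℝ}

theorem add (hf : PolyGrowthH n f) (hg : PolyGrowthH n g) : PolyGrowthH n (f + g) := by
  obtain ⟨hf, fh, hfh⟩ := hf
  obtain ⟨hg, gh, hgh⟩ := hg
  refine ⟨hf.add hg, fh + gh, fun B hB ε hε => ?_⟩
  obtain ⟨δ₁, hδ₁, h₁⟩ := hfh B hB (ε / 2) (half_pos hε)
  obtain ⟨δ₂, hδ₂, h₂⟩ := hgh B hB (ε / 2) (half_pos hε)
  refine ⟨min δ₁ δ₂, lt_min hδ₁ hδ₂, fun t ht htδ y hy => ?_⟩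
  have e₁ := h₁ t ht (htδ.trans_le (min_le_left _ _)) y hy
  have e₂ := h₂ t ht (htδ.trans_le (min_le_right _ _)) y hy
  have e : (f + g) (t • y) / t - (fh + gh) y
      = (f (t • y) / t - fh y) + (g (t • y) / t - gh y) := by
    simp only [Pi.add_apply]; ring
  rw [e]
  linarith [abs_add_le (f (t • y) / t - fh y) (g (t • y) / t - gh y)]

theorem sup (hf : PolyGrowthH n f) (hg : PolyGrowthH n g) : PolyGrowthH n (f ⊔ g) := by
  obtain ⟨hf, fh, hfh⟩ := hf
  obtain ⟨hg, gh, hgh⟩ := hg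
  refine ⟨hf.sup hg, fh ⊔ gh, fun B hB ε hε => ?_⟩
  obtain ⟨δ₁, hδ₁, h₁⟩ := hfh B hB ε hε
  obtain ⟨δ₂, hδ₂, h₂⟩ := hgh B hB ε hε
  refine ⟨min δ₁ δ₂, lt_min hδ₁ hδ₂, fun t ht htδ y hy => ?_⟩
  have e₁ := h₁ t ht (htδ.trans_le (min_le_left _ _)) y hy
  have e₂ := h₂ t ht (htδ.trans_le (min_le_right _ _)) y hy
  have e : (f ⊔ g) (t • y) / t = max (f (t • y) / t) (g (t • y) / t) :=
    max_div_div_right ht.le _ _ |>.symm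
  rw [e]
  exact (abs_max_sub_max_le_max _ _ _ _).trans_lt (max_lt e₁ e₂)

theorem smul (c : ℝ) (hf : PolyGrowthH n f) : PolyGrowthH n (c • f) := by
  obtain ⟨hf, fh, hfh⟩ := hf
  refine ⟨hf.smul c, c • fh, fun B hB ε hε => ?_⟩
  have hc : 0 < |c| + 1 := by positivity
  obtain ⟨δ, hδ, h⟩ := hfh B hB (ε / (|c| + 1)) (div_pos hε hc)
  refine ⟨δ, hδ, fun t ht htδ y hy => ?_⟩
  have e : (c • f) (t • y) / t - (c • fh) y = c * (f (t • y) / t - fh y) := by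
    simp only [Pi.smul_apply, smul_eq_mul]; ring
  rw [e, abs_mul]
  have h' := (lt_div_iff₀ hc).1 (h t ht htδ y hy)
  linarith [abs_nonneg (f (t • y) / t - fh y)]

theorem proj (i : Fin n) : PolyGrowthH n fun t => t i := by
  refine ⟨.proj i, fun t => t i, fun B _ ε hε => ⟨1, one_pos, fun _ ht _ y _ => ?_⟩⟩
  simpa [mul_div_cancel_left₀ _ ht.ne'] using hε

/-- The difference quotients `f (t • y) / t` are uniformly bounded for small `t > 0` and `y` in a
bounded set. -/
theorem exists_abs_div_le (hf : PolyGrowthH n f) {B : Set (Fin n → ℝ)}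
    (hB : Bornology.IsBounded B) :
    ∃ K δ : ℝ, 0 < K ∧ 0 < δ ∧ ∀ t : ℝ, 0 < t → t < δ → ∀ y ∈ B, |f (t • y) / t| ≤ K := by
  obtain ⟨⟨hfc, -⟩, fh, hfh⟩ := hf
  obtain ⟨δ, hδ, h⟩ := hfh B hB 1 one_pos
  have hq : Continuous fun y : Fin n → ℝ => f ((δ / 2) • y) / (δ / 2) :=
    (hfc.comp (continuous_const_smul _)).div_const _
  obtain ⟨C, hC⟩ := hB.isCompact_closure.exists_bound_of_continuousOn hq.continuousOn
  refine ⟨|C| + 2, δ, by positivity, hδ, fun t ht htδ y hy => ?_⟩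
  have e₁ := abs_lt.1 (h t ht htδ y hy)
  have e₂ := abs_lt.1 (h (δ / 2) (half_pos hδ) (half_lt_self hδ) y hy)
  have e₃ := abs_le.1 ((hC y (subset_closure hy)).trans (le_abs_self C))
  rw [abs_le]
  constructor <;> linarith [e₁.1, e₁.2, e₂.1, e₂.2, e₃.1, e₃.2]

theorem mul (hf : PolyGrowthH n f) (hg : PolyGrowthH n g) : PolyGrowthH n (f * g) := by
  refine ⟨hf.1.mul hg.1, 0, fun B hB ε hε => ?_⟩
  obtain ⟨K₁, δ₁, hK₁, hδ₁, h₁⟩ := hf.exists_abs_div_le hB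
  obtain ⟨K₂, δ₂, hK₂, hδ₂, h₂⟩ := hg.exists_abs_div_le hB
  have hK : 0 < K₁ * K₂ := mul_pos hK₁ hK₂
  refine ⟨min (min δ₁ δ₂) (ε / (K₁ * K₂)), lt_min (lt_min hδ₁ hδ₂) (div_pos hε hK),
    fun t ht htδ y hy => ?_⟩
  obtain ⟨⟨ht₁, ht₂⟩, ht₃⟩ := by simpa only [lt_min_iff] using htδ
  have e : (f * g) (t • y) / t - (0 : (Fin n → ℝ) → ℝ) y
      = t * (f (t • y) / t * (g (t • y) / t)) := by
    simp only [Pi.mul_apply, Pi.zero_apply]; field_simp; ring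
  rw [e, abs_mul, abs_mul, abs_of_pos ht]
  calc t * (|f (t • y) / t| * |g (t • y) / t|) ≤ t * (K₁ * K₂) := by
        gcongr
        exacts [h₁ t ht ht₁ y hy, h₂ t ht ht₂ y hy]
    _ < ε := (lt_div_iff₀ hK).1 ht₃

end PolyGrowthH

/-- The pointwise identity behind the `f`-algebra condition. -/
theorem min_max_zero_mul_sub_min_eq_zero (a b z : ℝ) :
    min (max 0 z * (a - min a b)) (b - min a b) = 0 := by
  rcases le_total a b with h | h
  · simp [h]
  · simp only [min_eq_right h, sub_self]
    exact min_eq_right (mul_nonneg (le_max_left _ _) (sub_nonneg.2 h))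

/-- Theorem 4.1: a vector space with a sufficiently strong polynomial
growth continuous function calculus without constants is a commutative `f`-algebra.
The order is defined by `a ≤ b ↔ Ψ_{(a,b)}(π₁ ∨ π₂) = b` and the product by
`a · b = Ψ_{(a,b)}(π₁ · π₂)`. -/
theorem stmt_15 {X : Type*} [AddCommGroup X] [Module ℝ X]
    (Ψ : ∀ (n : ℕ) (x : Fin n → X) (f : (Fin n → ℝ) → ℝ), PolyGrowthH n f → X)
    (hadd : ∀ (n : ℕ) (x : Fin n → X) (f g : (Fin n → ℝ) → ℝ)
      (hf : PolyGrowthH n f) (hg : PolyGrowthH n g) (hfg : PolyGrowthH n (f + g)),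
      Ψ n x (f + g) hfg = Ψ n x f hf + Ψ n x g hg)
    (hsmul : ∀ (n : ℕ) (x : Fin n → X) (c : ℝ) (f : (Fin n → ℝ) → ℝ)
      (hf : PolyGrowthH n f) (hcf : PolyGrowthH n (c • f)),
      Ψ n x (c • f) hcf = c • Ψ n x f hf)
    (hproj : ∀ (n : ℕ) (x : Fin n → X) (i : Fin n) (hi : PolyGrowthH n fun t => t i),
      Ψ n x (fun t => t i) hi = x i)
    (hcomp : ∀ (m n : ℕ) (x : Fin n → X) (f : Fin m → ((Fin n → ℝ) → ℝ))
      (hf : ∀ j, PolyGrowthH n (f j)) (g : (Fin m → ℝ) → ℝ) (hg : PolyGrowthH m g)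
      (hgf : PolyGrowthH n fun t => g fun j => f j t),
      Ψ m (fun j => Ψ n x (f j) (hf j)) g hg = Ψ n x (fun t => g fun j => f j t) hgf) :
    ∀ (hσ : PolyGrowthH 2 fun t => t 0 ⊔ t 1) (hρ : PolyGrowthH 2 fun t => t 0 * t 1),
    let s : X → X → X := fun a b => Ψ 2 ![a, b] (fun t => t 0 ⊔ t 1) hσ
    let p : X → X → X := fun a b => Ψ 2 ![a, b] (fun t => t 0 * t 1) hρ
    let le : X → X → Prop := fun a b => s a b = b
    let inf' : X → X → X := fun a b => -s (-a) (-b)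
    -- `le` is a partial order
    (∀ a, le a a) ∧
    (∀ a b, le a b → le b a → a = b) ∧
    (∀ a b c, le a b → le b c → le a c) ∧
    -- `s a b` is the supremum and `inf' a b` the infimum of `a` and `b` for `le`
    (∀ a b, le a (s a b) ∧ le b (s a b) ∧ ∀ c, le a c → le b c → le (s a b) c) ∧
    (∀ a b, le (inf' a b) a ∧ le (inf' a b) b ∧ ∀ c, le c a → le c b → le c (inf' a b)) ∧
    -- `le` makes `X` a vector lattice
    (∀ a b c, le a b → le (a + c) (b + c)) ∧
    (∀ (r : ℝ) (a : X), 0 ≤ r → le 0 a → le 0 (r • a)) ∧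
    -- the product is commutative, associative and bilinear
    (∀ a b, p a b = p b a) ∧
    (∀ a b c, p (p a b) c = p a (p b c)) ∧
    (∀ a b c, p a (b + c) = p a b + p a c) ∧
    (∀ a b c, p (a + b) c = p a c + p b c) ∧
    (∀ (r : ℝ) (a b : X), p (r • a) b = r • p a b ∧ p a (r • b) = r • p a b) ∧
    -- products of positives are positive: `X` is a lattice-ordered algebra
    (∀ a b, le 0 a → le 0 b → le 0 (p a b)) ∧
    -- `X` is an `f`-algebra
    (∀ a b z, inf' a b = 0 → le 0 z → inf' (p z a) b = 0 ∧ inf' (p a z) b = 0) ∧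
    -- each `Ψ n x` is a lattice-algebra homomorphism for these structures
    (∀ (n : ℕ) (x : Fin n → X) (f g : (Fin n → ℝ) → ℝ) (hf : PolyGrowthH n f)
      (hg : PolyGrowthH n g) (hfg : PolyGrowthH n (f ⊔ g)),
      Ψ n x (f ⊔ g) hfg = s (Ψ n x f hf) (Ψ n x g hg)) ∧
    (∀ (n : ℕ) (x : Fin n → X) (f g : (Fin n → ℝ) → ℝ) (hf : PolyGrowthH n f)
      (hg : PolyGrowthH n g) (hfg : PolyGrowthH n (f * g)),
      Ψ n x (f * g) hfg = p (Ψ n x f hf) (Ψ n x g hg)) := by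
  intro hσ hρ s p le inf'
  have hs : ∀ (n : ℕ) (x : Fin n → X) (f g : (Fin n → ℝ) → ℝ) (hf : PolyGrowthH n f)
      (hg : PolyGrowthH n g), s (Ψ n x f hf) (Ψ n x g hg) = Ψ n x (f ⊔ g) (hf.sup hg) := by
    intro n x f g hf hg
    have hfg : ∀ j, PolyGrowthH n ((![f, g] : Fin 2 → (Fin n → ℝ) → ℝ) j) :=
      Fin.forall_fin_two.2 ⟨hf, hg⟩
    refine Eq.trans ?_ (hcomp 2 n x ![f, g] hfg _ hσ (hf.sup hg))
    simp only [s]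
    congr 1
    ext j
    fin_cases j <;> rfl
  have hp : ∀ (n : ℕ) (x : Fin n → X) (f g : (Fin n → ℝ) → ℝ) (hf : PolyGrowthH n f)
      (hg : PolyGrowthH n g), p (Ψ n x f hf) (Ψ n x g hg) = Ψ n x (f * g) (hf.mul hg) := by
    intro n x f g hf hg
    have hfg : ∀ j, PolyGrowthH n ((![f, g] : Fin 2 → (Fin n → ℝ) → ℝ) j) :=
      Fin.forall_fin_two.2 ⟨hf, hg⟩
    refine Eq.trans ?_ (hcomp 2 n x ![f, g] hfg _ hρ (hf.mul hg))
    simp only [p]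
    congr 1
    ext j
    fin_cases j <;> rfl
  have ha : ∀ (n : ℕ) (x : Fin n → X) (f g : (Fin n → ℝ) → ℝ) (hf : PolyGrowthH n f)
      (hg : PolyGrowthH n g), Ψ n x f hf + Ψ n x g hg = Ψ n x (f + g) (hf.add hg) :=
    fun n x f g hf hg => (hadd n x f g hf hg _).symm
  have hm : ∀ (n : ℕ) (x : Fin n → X) (c : ℝ) (f : (Fin n → ℝ) → ℝ) (hf : PolyGrowthH n f),
      c • Ψ n x f hf = Ψ n x (c • f) (hf.smul c) :=
    fun n x c f hf => (hsmul n x c f hf _).symm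
  have rep : ∀ a b c : X, ∃ x : Fin 3 → X, a = Ψ 3 x (fun t => t 0) (.proj 0) ∧
      b = Ψ 3 x (fun t => t 1) (.proj 1) ∧ c = Ψ 3 x (fun t => t 2) (.proj 2) :=
    fun a b c => ⟨![a, b, c], by simp [hproj]⟩
  clear_value s p
  have s_self : ∀ a, s a a = a := by
    intro a
    obtain ⟨x, rfl, -, -⟩ := rep a a a
    simp only [hs, sup_idem]
  have s_comm : ∀ a b, s a b = s b a := by
    intro a b
    obtain ⟨x, rfl, rfl, -⟩ := rep a b b
    simp only [hs, sup_comm]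
  have s_assoc : ∀ a b c, s (s a b) c = s a (s b c) := by
    intro a b c
    obtain ⟨x, rfl, rfl, rfl⟩ := rep a b c
    simp only [hs, sup_assoc]
  have s_add : ∀ a b c, s (a + c) (b + c) = s a b + c := by
    intro a b c
    obtain ⟨x, rfl, rfl, rfl⟩ := rep a b c
    simp only [hs, ha, sup_add]
  have s_smul : ∀ (r : ℝ) a b, 0 ≤ r → s (r • a) (r • b) = r • s a b := by
    intro r a b hr
    obtain ⟨x, rfl, rfl, -⟩ := rep a b b
    simp only [hs, hm]
    congr 1
    ext t
    exact (mul_max_of_nonneg _ _ hr).symm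
  have p_comm : ∀ a b, p a b = p b a := by
    intro a b
    obtain ⟨x, rfl, rfl, -⟩ := rep a b b
    simp only [hp, mul_comm]
  have p_assoc : ∀ a b c, p (p a b) c = p a (p b c) := by
    intro a b c
    obtain ⟨x, rfl, rfl, rfl⟩ := rep a b c
    simp only [hp, mul_assoc]
  have p_add : ∀ a b c, p a (b + c) = p a b + p a c := by
    intro a b c
    obtain ⟨x, rfl, rfl, rfl⟩ := rep a b c
    simp only [hp, ha, mul_add]
  have p_smul : ∀ (r : ℝ) a b, p a (r • b) = r • p a b := by
    intro r a b
    obtain ⟨x, rfl, rfl, -⟩ := rep a b b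
    simp only [hp, hm, mul_smul_comm]
  have p_nonneg : ∀ a b, s 0 (p (s 0 a) (s 0 b)) = p (s 0 a) (s 0 b) := by
    intro a b
    obtain ⟨x, rfl, rfl, -⟩ := rep a b b
    rw [← zero_smul ℝ (Ψ 3 x (fun t => t 0) (.proj 0))]
    simp only [hs, hp, hm]
    congr 1
    ext t
    simp [mul_nonneg]
  have inf_mul : ∀ a b z, inf' (p (s 0 z) (a - inf' a b)) (b - inf' a b) = 0 := by
    intro a b z
    obtain ⟨x, rfl, rfl, rfl⟩ := rep a b z
    simp only [inf', sub_eq_add_neg]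
    rw [← zero_smul ℝ (Ψ 3 x (fun t => t 0) (.proj 0))]
    simp only [← neg_one_smul ℝ (Ψ 3 x _ _), hs, hp, hm, ha]
    congr 1
    ext t
    have h := congrArg Neg.neg (min_max_zero_mul_sub_min_eq_zero (t 0) (t 1) (t 2))
    rw [← max_neg_neg] at h
    simpa [max_neg_neg, sub_eq_add_neg, add_comm] using h
  have le_add : ∀ a b c, le a b → le (a + c) (b + c) := by
    intro a b c h
    simp only [le] at h ⊢
    rw [s_add, h]
  have le_neg : ∀ a b, le a b → le (-b) (-a) := by
    intro a b h
    have := le_add a b (-a + -b) h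
    rwa [add_neg_cancel_left, add_comm (-a), add_neg_cancel_left] at this
  have le_left : ∀ a b, le a (s a b) := by
    intro a b
    simp only [le]
    rw [← s_assoc, s_self]
  have le_right : ∀ a b, le b (s a b) := by
    intro a b
    rw [s_comm]
    exact le_left b a
  have s_le : ∀ a b c, le a c → le b c → le (s a b) c := by
    intro a b c hac hbc
    simp only [le] at hac hbc ⊢
    rw [s_assoc, hbc, hac]
  refine ⟨s_self, fun a b hab hba => ?_, fun a b c hab hbc => ?_,
    fun a b => ⟨le_left a b, le_right a b, s_le a b⟩,
    fun a b => ⟨?_, ?_, fun c hca hcb => ?_⟩, le_add, fun r a hr h => ?_, p_comm, p_assoc, p_add,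
    fun a b c => ?_, fun r a b => ⟨?_, p_smul r a b⟩, fun a b h₁ h₂ => ?_,
    fun a b z hab hz => ?_, fun n x f g hf hg _ => (hs n x f g hf hg).symm,
    fun n x f g hf hg _ => (hp n x f g hf hg).symm⟩
  · exact hba.symm.trans ((s_comm b a).trans hab)
  · simp only [le] at hab hbc ⊢
    rw [← hbc, ← s_assoc, hab]
  · simpa using le_neg _ _ (le_left (-a) (-b))
  · simpa using le_neg _ _ (le_right (-a) (-b))
  · simpa using le_neg _ _ (s_le _ _ _ (le_neg _ _ hca) (le_neg _ _ hcb))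
  · have h' := s_smul r 0 a hr
    rw [smul_zero, show s 0 a = a from h] at h'
    exact h'
  · rw [p_comm, p_add, p_comm c a, p_comm c b]
  · rw [p_comm, p_smul, p_comm]
  · have h := p_nonneg a b
    rwa [show s 0 a = a from h₁, show s 0 b = b from h₂] at h
  · have h := inf_mul a b z
    rw [hab, show s 0 z = z from hz, sub_zero, sub_zero] at h
    exact ⟨h, p_comm a z ▸ h⟩
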